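/- (STLC in the symmetric-magnetization case.) Let Assumption A hold and suppose in addition M1 + M2 = 0. Then the system ż = F0(z) + H∥(t) F1(z) + H⊥(t) F2(z) is small-time locally controllable at every equilibrium z^e = (x^e, y^e, θ^e, 0): for every neighborhood W of z^e in ℝ⁴, every T > 0 and every ε > 0, there exists a neighborhood V ⊆ W of z^e such that for all z^i, z^f ∈ V there exist bounded measurable controls H∥, H⊥ : [0,T] → ℝ with ‖H∥‖∞ < ε and ‖H⊥‖∞ < ε, and an absolutely continuous z : [0,T] → ℝ⁴ solving the ODE almost everywhere with z(0) = z^i, z(T) = z^f, and z(t) ∈ W for all t ∈ [0,T]. -/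

import Mathlib

open Real Matrix Set

/-- The 4×4 matrix E(α) of the two-link magneto-elastic swimmer,
with blocks E11, E12, E21, E22 as in the paper. -/
noncomputable def Emat (l1 l2 x1 x2 e1 e2 a : ℝ) : Matrix (Fin 4) (Fin 4) ℝ :=
  !![ -(x1*l1 + x2*l2) * Real.cos a, -(x1*l1 + e2*l2) * Real.sin a,
        (1/2)*x1*l1*l2*Real.sin a, 0;
      (e1*l1 + x2*l2) * Real.sin a, -(e1*l1 + e2*l2) * Real.cos a,
        (1/2)*e1*l1*(l1 + l2*Real.cos a), (1/2)*e1*l1^2;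
      (1/2)*(e1*l1^2*(-Real.sin a)), (1/2)*(e1*l1^2*Real.cos a - e2*l2^2),
        -(e1*l1^2*((1/4)*l2*Real.cos a + (1/3)*l1) + e2*l2^2*((1/12)*l2)),
        -(e1*l1^2*((1/3)*l1));
      0, (1/2)*(-(e2*l2^2)), -(e2*l2^2*((1/12)*l2)), 0]

/-- R̃(θ) = diag(R_θ, I₂). -/
noncomputable def Rtil (th : ℝ) : Matrix (Fin 4) (Fin 4) ℝ :=
  !![Real.cos th, -Real.sin th, 0, 0;
     Real.sin th,  Real.cos th, 0, 0;
     0, 0, 1, 0;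
     0, 0, 0, 1]

/-- X3(z) = R̃(θ)·(third column of E(α)⁻¹), where z = (x,y,θ,α). -/
noncomputable def X3 (l1 l2 x1 x2 e1 e2 : ℝ) (z : Fin 4 → ℝ) : Fin 4 → ℝ :=
  (Rtil (z 2)).mulVec fun i => (Emat l1 l2 x1 x2 e1 e2 (z 3))⁻¹ i 2

/-- X4(z) = R̃(θ)·(fourth column of E(α)⁻¹), where z = (x,y,θ,α). -/
noncomputable def X4 (l1 l2 x1 x2 e1 e2 : ℝ) (z : Fin 4 → ℝ) : Fin 4 → ℝ :=
  (Rtil (z 2)).mulVec fun i => (Emat l1 l2 x1 x2 e1 e2 (z 3))⁻¹ i 3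

/-- F0(z) = κ α X4(z). -/
noncomputable def F0 (l1 l2 x1 x2 e1 e2 k : ℝ) (z : Fin 4 → ℝ) : Fin 4 → ℝ :=
  (k * z 3) • X4 l1 l2 x1 x2 e1 e2 z

/-- F1(z) = M1 sin α · X3(z). -/
noncomputable def F1 (l1 l2 x1 x2 e1 e2 M1 : ℝ) (z : Fin 4 → ℝ) : Fin 4 → ℝ :=
  (M1 * Real.sin (z 3)) • X3 l1 l2 x1 x2 e1 e2 z

/-- F2(z) = −(M1 cos α + M2) X3(z) − M2 X4(z). -/
noncomputable def F2 (l1 l2 x1 x2 e1 e2 M1 M2 : ℝ) (z : Fin 4 → ℝ) : Fin 4 → ℝ :=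
  (-(M1 * Real.cos (z 3) + M2)) • X3 l1 l2 x1 x2 e1 e2 z
    - M2 • X4 l1 l2 x1 x2 e1 e2 z

/-- Lie bracket of two vector fields on ℝ⁴: [X,Y](z) = DY(z)·X(z) − DX(z)·Y(z). -/
noncomputable def lieBr (X Y : (Fin 4 → ℝ) → (Fin 4 → ℝ)) (z : Fin 4 → ℝ) : Fin 4 → ℝ :=
  fderiv ℝ Y z (X z) - fderiv ℝ X z (Y z)

/-- The origin O = (0,0,0,0). -/
def Ovec : Fin 4 → ℝ := ![0, 0, 0, 0]

/-- Assumption A of the paper. -/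
def AssumptionA (l1 l2 x1 x2 e1 e2 M1 M2 : ℝ) : Prop :=
  ((e1 - x1, e2 - x2) ≠ (0, 0)) ∧ x1 ≤ e1 ∧ x2 ≤ e2 ∧ M1 ≠ 0 ∧ M2 ≠ 0 ∧
    (3 + 4*(l2/l1) + e2*l2^2/(e1*l1^2)) * M1
      - (3 + 4*(l1/l2) + e1*l1^2/(e2*l2^2)) * M2 ≠ 0

def Steers (F : ℝ → ℝ → (Fin 4 → ℝ) → Fin 4 → ℝ) (W : Set (Fin 4 → ℝ)) (ε τ : ℝ)
    (p q : Fin 4 → ℝ) : Prop :=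
  ∃ a b : ℝ → ℝ, Measurable a ∧ Measurable b ∧
    (∀ t ∈ Icc (0:ℝ) τ, |a t| < ε) ∧ (∀ t ∈ Icc (0:ℝ) τ, |b t| < ε) ∧
    ∃ z : ℝ → Fin 4 → ℝ, z 0 = p ∧ z τ = q ∧ (∀ t ∈ Icc (0:ℝ) τ, z t ∈ W) ∧
      IntervalIntegrable (fun s => F (a s) (b s) (z s)) MeasureTheory.volume 0 τ ∧
      ∀ t ∈ Icc (0:ℝ) τ, z t = p + ∫ s in (0:ℝ)..t, F (a s) (b s) (z s)

theorem Steers.trans {F : ℝ → ℝ → (Fin 4 → ℝ) → Fin 4 → ℝ} {W : Set (Fin 4 → ℝ)}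
    {ε τ₁ τ₂ : ℝ} {p q r : Fin 4 → ℝ} (hτ₁ : 0 ≤ τ₁) (hτ₂ : 0 ≤ τ₂)
    (h₁ : Steers F W ε τ₁ p q) (h₂ : Steers F W ε τ₂ q r) : Steers F W ε (τ₁ + τ₂) p r := by
  obtain ⟨a₁, b₁, ha₁, hb₁, ba₁, bb₁, z₁, z₁0, z₁τ, z₁W, i₁, e₁⟩ := h₁
  obtain ⟨a₂, b₂, ha₂, hb₂, ba₂, bb₂, z₂, z₂0, z₂τ, z₂W, i₂, e₂⟩ := h₂
  have hmem : ∀ {t : ℝ}, t ∈ Icc 0 (τ₁ + τ₂) → ¬ t ≤ τ₁ → t - τ₁ ∈ Icc 0 τ₂ := by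
    intro t ht h
    exact ⟨by linarith, by linarith [ht.2]⟩
  let a : ℝ → ℝ := fun t => if t ≤ τ₁ then a₁ t else a₂ (t - τ₁)
  let b : ℝ → ℝ := fun t => if t ≤ τ₁ then b₁ t else b₂ (t - τ₁)
  let z : ℝ → Fin 4 → ℝ := fun t => if t ≤ τ₁ then z₁ t else z₂ (t - τ₁)
  have f₁ : ∀ t, t ≤ τ₁ → F (a₁ t) (b₁ t) (z₁ t) = F (a t) (b t) (z t) := by
    intro t h; simp only [a, b, z, if_pos h]
  have f₂ : ∀ t, τ₁ < t →
      F (a₂ (t - τ₁)) (b₂ (t - τ₁)) (z₂ (t - τ₁)) = F (a t) (b t) (z t) := by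
    intro t h; simp only [a, b, z, if_neg h.not_ge]
  have j₁ : IntervalIntegrable (fun s => F (a s) (b s) (z s)) MeasureTheory.volume 0 τ₁ := by
    refine i₁.congr ?_
    intro t ht
    rw [uIoc_of_le hτ₁] at ht
    exact f₁ t ht.2
  have j₂ : IntervalIntegrable (fun s => F (a s) (b s) (z s)) MeasureTheory.volume
      τ₁ (τ₁ + τ₂) := by
    have := i₂.comp_sub_right τ₁
    rw [zero_add, add_comm τ₂] at this
    refine this.congr ?_
    intro t ht
    rw [uIoc_of_le (by linarith)] at ht
    exact f₂ t ht.1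
  refine ⟨a, b, ?_, ?_, ?_, ?_, z, ?_, ?_, ?_, j₁.trans j₂, ?_⟩
  · exact Measurable.ite measurableSet_Iic ha₁ (ha₂.comp (measurable_id.sub_const _))
  · exact Measurable.ite measurableSet_Iic hb₁ (hb₂.comp (measurable_id.sub_const _))
  · intro t ht
    by_cases h : t ≤ τ₁
    · simpa only [a, if_pos h] using ba₁ t ⟨ht.1, h⟩
    · simpa only [a, if_neg h] using ba₂ _ (hmem ht h)
  · intro t ht
    by_cases h : t ≤ τ₁
    · simpa only [b, if_pos h] using bb₁ t ⟨ht.1, h⟩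
    · simpa only [b, if_neg h] using bb₂ _ (hmem ht h)
  · simpa only [z, if_pos hτ₁] using z₁0
  · by_cases h : τ₁ + τ₂ ≤ τ₁
    · have : τ₂ = 0 := by linarith
      subst this
      simp only [z, add_zero, le_refl, if_true, z₁τ, ← z₂0, z₂τ]
    · simp only [z, if_neg h, add_sub_cancel_left, z₂τ]
  · intro t ht
    by_cases h : t ≤ τ₁
    · simpa only [z, if_pos h] using z₁W t ⟨ht.1, h⟩
    · simpa only [z, if_neg h] using z₂W _ (hmem ht h)
  · have k₁ : ∀ t ∈ Icc 0 τ₁, ∫ s in (0:ℝ)..t, F (a s) (b s) (z s)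
        = ∫ s in (0:ℝ)..t, F (a₁ s) (b₁ s) (z₁ s) := by
      intro t ht
      refine intervalIntegral.integral_congr fun s hs => ?_
      rw [uIcc_of_le ht.1] at hs
      exact (f₁ s (hs.2.trans ht.2)).symm
    intro t ht
    by_cases h : t ≤ τ₁
    · rw [k₁ t ⟨ht.1, h⟩, ← e₁ t ⟨ht.1, h⟩]
      simp only [z, if_pos h]
    · have h' : τ₁ < t := not_le.1 h
      have k₂ : ∫ s in τ₁..t, F (a s) (b s) (z s)
          = ∫ s in (0:ℝ)..(t - τ₁), F (a₂ s) (b₂ s) (z₂ s) := by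
        have := intervalIntegral.integral_comp_sub_right (a := τ₁) (b := t)
          (fun s => F (a₂ s) (b₂ s) (z₂ s)) τ₁
        rw [sub_self] at this
        rw [← this]
        refine intervalIntegral.integral_congr_ae (Filter.Eventually.of_forall fun s hs => ?_)
        rw [uIoc_of_le h'.le] at hs
        exact (f₂ s hs.1).symm
      have j₃ : IntervalIntegrable (fun s => F (a s) (b s) (z s)) MeasureTheory.volume τ₁ t :=
        j₂.mono_set (by
          rw [uIcc_of_le h'.le, uIcc_of_le (by linarith)]
          exact Icc_subset_Icc_right ht.2)
      rw [← intervalIntegral.integral_add_adjacent_intervals j₁ j₃, k₂,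
        k₁ τ₁ ⟨hτ₁, le_rfl⟩, ← add_assoc, ← e₁ τ₁ ⟨hτ₁, le_rfl⟩, z₁τ, ← e₂ _ (hmem ht h)]
      simp only [z, if_neg h]

theorem Steers.of_hasDerivAt {F : ℝ → ℝ → (Fin 4 → ℝ) → Fin 4 → ℝ} {W : Set (Fin 4 → ℝ)}
    {ε τ : ℝ} (hτ : 0 ≤ τ) {a b : ℝ → ℝ} (ha : Measurable a) (hb : Measurable b)
    (ba : ∀ t ∈ Icc (0:ℝ) τ, |a t| < ε) (bb : ∀ t ∈ Icc (0:ℝ) τ, |b t| < ε)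
    {z z' : ℝ → Fin 4 → ℝ} (hz' : Continuous z') (hz : ∀ t, HasDerivAt z (z' t) t)
    (hW : ∀ t ∈ Icc (0:ℝ) τ, z t ∈ W)
    (hF : ∀ t ∈ Icc (0:ℝ) τ, z' t = F (a t) (b t) (z t)) :
    Steers F W ε τ (z 0) (z τ) := by
  refine ⟨a, b, ha, hb, ba, bb, z, rfl, rfl, hW, ?_, ?_⟩
  · refine (hz'.intervalIntegrable 0 τ).congr fun t ht => ?_
    rw [uIoc_of_le hτ] at ht
    exact hF t ⟨ht.1.le, ht.2⟩
  · intro t ht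
    have h₁ : ∫ s in (0:ℝ)..t, F (a s) (b s) (z s) = ∫ s in (0:ℝ)..t, z' s := by
      refine intervalIntegral.integral_congr fun s hs => ?_
      rw [uIcc_of_le ht.1] at hs
      exact (hF s ⟨hs.1, hs.2.trans ht.2⟩).symm
    rw [h₁, intervalIntegral.integral_eq_sub_of_hasDerivAt (fun s _ => hz s)
      (hz'.intervalIntegrable 0 t)]
    abel

/-- The drift-plus-control field of the swimmer for opposite magnetizations, written in terms of
the fields `X`, `Y` dual to the two torque balances. -/
noncomputable def torqueField (k M : ℝ) (X Y : (Fin 4 → ℝ) → Fin 4 → ℝ) (a b : ℝ)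
    (z : Fin 4 → ℝ) : Fin 4 → ℝ :=
  (k * z 3 + M * b) • Y z + (M * (Real.sin (z 3) * a + (1 - Real.cos (z 3)) * b)) • X z

/-- Data straightening two translation- and rotation-invariant fields near `α = 0`: a multiple of
`Y` moves along the shape curve `θ = φ + G α`, and a combination of `X` and `Y` rotates rigidly at
frozen `α`. -/
structure ShapeChart (X Y : (Fin 4 → ℝ) → Fin 4 → ℝ) (r : ℝ) where
  (β g h₁ h₂ p₁ p₂ c d G S₁ S₂ : ℝ → ℝ)
  continuous_β : Continuous β
  continuous_g : Continuous g
  continuous_h₁ : Continuous h₁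
  continuous_h₂ : Continuous h₂
  hasDerivAt_G : ∀ α, HasDerivAt G (g α) α
  hasDerivAt_S₁ : ∀ α, HasDerivAt S₁ (Real.cos (G α) * h₁ α - Real.sin (G α) * h₂ α) α
  hasDerivAt_S₂ : ∀ α, HasDerivAt S₂ (Real.sin (G α) * h₁ α + Real.cos (G α) * h₂ α) α
  G_zero : G 0 = 0
  S₁_zero : S₁ 0 = 0
  S₂_zero : S₂ 0 = 0
  smul_Y : ∀ z : Fin 4 → ℝ, |z 3| ≤ r → β (z 3) • Y z =
    ![Real.cos (z 2) * h₁ (z 3) - Real.sin (z 2) * h₂ (z 3),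
      Real.sin (z 2) * h₁ (z 3) + Real.cos (z 2) * h₂ (z 3), g (z 3), 1]
  rotation : ∀ z : Fin 4 → ℝ, |z 3| ≤ r → c (z 3) • X z + d (z 3) • Y z =
    ![Real.cos (z 2) * p₁ (z 3) - Real.sin (z 2) * p₂ (z 3),
      Real.sin (z 2) * p₁ (z 3) + Real.cos (z 2) * p₂ (z 3), 1, 0]

namespace ShapeChart

variable {X Y : (Fin 4 → ℝ) → Fin 4 → ℝ} {r : ℝ} (D : ShapeChart X Y r)

/-- The configuration with straightened coordinates `(u, v, φ, α)`. -/
noncomputable def frame (u v φ α : ℝ) : Fin 4 → ℝ :=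
  ![u + (Real.cos φ * D.S₁ α - Real.sin φ * D.S₂ α),
    v + (Real.sin φ * D.S₁ α + Real.cos φ * D.S₂ α), φ + D.G α, α]

/-- First component of the arm of the rigid rotation at frozen `α`. -/
noncomputable def N₁ (α : ℝ) : ℝ :=
  Real.cos (D.G α) * D.p₁ α - Real.sin (D.G α) * D.p₂ α + D.S₂ α

/-- Second component of the arm of the rigid rotation at frozen `α`. -/
noncomputable def N₂ (α : ℝ) : ℝ :=
  Real.sin (D.G α) * D.p₁ α + Real.cos (D.G α) * D.p₂ α - D.S₁ α

/-- Primitive in `φ` of the first component of the displacement at frozen `α`. -/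
noncomputable def A₁ (α φ : ℝ) : ℝ := Real.sin φ * D.N₁ α + Real.cos φ * D.N₂ α

/-- Primitive in `φ` of the second component of the displacement at frozen `α`. -/
noncomputable def A₂ (α φ : ℝ) : ℝ := Real.sin φ * D.N₂ α - Real.cos φ * D.N₁ α

theorem hasDerivAt_frame_shape (u v φ α : ℝ) :
    HasDerivAt (D.frame u v φ)
      ![Real.cos (φ + D.G α) * D.h₁ α - Real.sin (φ + D.G α) * D.h₂ α,
        Real.sin (φ + D.G α) * D.h₁ α + Real.cos (φ + D.G α) * D.h₂ α, D.g α, 1] α := by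
  have h1 := D.hasDerivAt_S₁ α
  have h2 := D.hasDerivAt_S₂ α
  rw [hasDerivAt_pi]
  intro i
  fin_cases i
  · refine (((h1.const_mul (Real.cos φ)).sub (h2.const_mul (Real.sin φ))).const_add u).congr_deriv
      ?_
    simp [Real.cos_add, Real.sin_add]; ring
  · refine (((h1.const_mul (Real.sin φ)).add (h2.const_mul (Real.cos φ))).const_add v).congr_deriv
      ?_
    simp [Real.cos_add, Real.sin_add]; ring
  · exact (D.hasDerivAt_G α).const_add φ
  · exact hasDerivAt_id α

theorem hasDerivAt_frame_rotation (u v φ α : ℝ) :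
    HasDerivAt (fun ψ => D.frame (u + D.A₁ α ψ) (v + D.A₂ α ψ) ψ α)
      ![Real.cos (φ + D.G α) * D.p₁ α - Real.sin (φ + D.G α) * D.p₂ α,
        Real.sin (φ + D.G α) * D.p₁ α + Real.cos (φ + D.G α) * D.p₂ α, 1, 0] φ := by
  have hs := Real.hasDerivAt_sin φ
  have hc := Real.hasDerivAt_cos φ
  rw [hasDerivAt_pi]
  intro i
  fin_cases i
  · refine ((((hs.mul_const (D.N₁ α)).add (hc.mul_const (D.N₂ α))).const_add u).add
      ((hc.mul_const (D.S₁ α)).sub (hs.mul_const (D.S₂ α)))).congr_deriv ?_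
    simp [Real.cos_add, Real.sin_add, N₁, N₂]; ring
  · refine ((((hs.mul_const (D.N₂ α)).sub (hc.mul_const (D.N₁ α))).const_add v).add
      ((hs.mul_const (D.S₁ α)).add (hc.mul_const (D.S₂ α)))).congr_deriv ?_
    simp [Real.cos_add, Real.sin_add, N₁, N₂]; ring
  · exact (hasDerivAt_id φ).add_const _
  · exact hasDerivAt_const φ α

theorem abs_A_sub_le (α φ ψ : ℝ) :
    |D.A₁ α φ - D.A₁ α ψ| ≤ (|D.N₁ α| + |D.N₂ α|) * |φ - ψ| ∧
    |D.A₂ α φ - D.A₂ α ψ| ≤ (|D.N₁ α| + |D.N₂ α|) * |φ - ψ| := by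
  have hs := abs_sin_sub_sin_le φ ψ
  have hc := abs_cos_sub_cos_le φ ψ
  have key : ∀ P Q x y w : ℝ, |x| ≤ w → |y| ≤ w → |x * P + y * Q| ≤ (|P| + |Q|) * w := by
    intro P Q x y w hx hy
    calc |x * P + y * Q| ≤ |x * P| + |y * Q| := abs_add_le _ _
      _ = |x| * |P| + |y| * |Q| := by rw [abs_mul, abs_mul]
      _ ≤ w * |P| + w * |Q| := by gcongr
      _ = _ := by ring
  constructor
  · have := key (D.N₁ α) (D.N₂ α) _ _ _ hs hc
    convert this using 2
    simp only [A₁]; ring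
  · have := key (-D.N₁ α) (D.N₂ α) _ _ _ hc hs
    rw [abs_neg] at this
    convert this using 2
    simp only [A₂]; ring

theorem A₁_symm_sub (α φ s : ℝ) : D.A₁ α (φ + s) - D.A₁ α (φ - s) =
    2 * Real.sin s * (Real.cos φ * D.N₁ α - Real.sin φ * D.N₂ α) := by
  simp only [A₁, Real.sin_add, Real.cos_add, Real.sin_sub, Real.cos_sub]; ring

theorem A₂_symm_sub (α φ s : ℝ) : D.A₂ α (φ + s) - D.A₂ α (φ - s) =
    2 * Real.sin s * (Real.sin φ * D.N₁ α + Real.cos φ * D.N₂ α) := by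
  simp only [A₂, Real.sin_add, Real.cos_add, Real.sin_sub, Real.cos_sub]; ring

theorem abs_affine_le {α α' ρ τ t : ℝ} (hτ : 0 < τ) (ht : t ∈ Icc 0 τ) (h : |α| ≤ ρ)
    (h' : |α'| ≤ ρ) : |α + (α' - α) / τ * t| ≤ ρ := by
  have e : α + (α' - α) / τ * t = (1 - t / τ) * α + t / τ * α' := by ring
  have h0 : 0 ≤ t / τ := div_nonneg ht.1 hτ.le
  have h1 : t / τ ≤ 1 := (div_le_one hτ).2 ht.2
  rw [abs_le] at *
  rw [e]
  constructor <;> nlinarith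

theorem abs_sin_div_le {α : ℝ} (h : |α| ≤ 1) : |Real.sin α / (1 + Real.cos α)| ≤ 1 ∧
    0 < 1 + Real.cos α := by
  have hc : 0 < Real.cos α := Real.cos_pos_of_le_one h
  have h1 : 0 < 1 + Real.cos α := by linarith
  refine ⟨?_, h1⟩
  rw [abs_div, abs_of_pos h1, div_le_one h1]
  linarith [Real.abs_sin_le_one α]

theorem exists_steers_shape {k M ε τ : ℝ} (hr : 0 < r) (hr1 : r ≤ 1) (hM : M ≠ 0) (hk : 0 < k)
    (hε : 0 < ε) (hτ : 0 < τ) :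
    ∃ ρ > 0, ρ ≤ r ∧ k * ρ < |M| * ε ∧ ∀ W : Set (Fin 4 → ℝ), ∀ ρ' ≤ ρ,
      ∀ u v φ α α' : ℝ, |α| ≤ ρ' → |α'| ≤ ρ' → (∀ s, |s| ≤ ρ' → D.frame u v φ s ∈ W) →
      Steers (torqueField k M X Y) W ε τ (D.frame u v φ α) (D.frame u v φ α') := by
  obtain ⟨B, hB⟩ := (isCompact_Icc (a := -r) (b := r)).exists_bound_of_continuousOn
    D.continuous_β.continuousOn
  have hB0 : 0 ≤ B := (norm_nonneg _).trans (hB 0 ⟨by linarith, hr.le⟩)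
  have hM' : 0 < |M| := abs_pos.2 hM
  set Q : ℝ := 2 * B / τ + k with hQ
  have hQ0 : 0 < Q := by positivity
  set ρ : ℝ := min r (|M| * ε / (2 * Q)) with hρ
  have hρ0 : 0 < ρ := lt_min hr (by positivity)
  have hρr : ρ ≤ r := min_le_left _ _
  have hQρ : Q * ρ < |M| * ε := by
    calc Q * ρ ≤ Q * (|M| * ε / (2 * Q)) := by gcongr; exact min_le_right _ _
      _ = |M| * ε / 2 := by field_simp
      _ < |M| * ε := half_lt_self (by positivity)
  refine ⟨ρ, hρ0, hρr, ?_, ?_⟩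
  · refine lt_of_le_of_lt ?_ hQρ
    gcongr
    have : 0 ≤ 2 * B / τ := by positivity
    linarith
  intro W ρ' hρ' u v φ α α' hα hα' hW
  set s : ℝ := (α' - α) / τ with hs
  have hsle : |s| ≤ 2 * ρ / τ := by
    rw [hs, abs_div, abs_of_pos hτ]
    gcongr
    calc |α' - α| ≤ |α'| + |α| := abs_sub _ _
      _ ≤ 2 * ρ := by linarith
  let p : ℝ → ℝ := fun t => α + s * t
  have hp : ∀ t, HasDerivAt p s t := fun t =>
    (((hasDerivAt_id t).const_mul s).const_add α).congr_deriv (mul_one s)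
  have hpc : Continuous p := continuous_iff_continuousAt.2 fun t => (hp t).continuousAt
  have hpρ' : ∀ t ∈ Icc 0 τ, |p t| ≤ ρ' := fun t ht => abs_affine_le hτ ht hα hα'
  have hpρ : ∀ t ∈ Icc 0 τ, |p t| ≤ ρ := fun t ht => (hpρ' t ht).trans hρ'
  let b : ℝ → ℝ := fun t => (s * D.β (p t) - k * p t) / M
  let a : ℝ → ℝ := fun t => -(Real.sin (p t) / (1 + Real.cos (p t))) * b t
  have hbc : Continuous b :=
    ((continuous_const.mul (D.continuous_β.comp hpc)).sub (continuous_const.mul hpc)).div_const M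
  have hbm : Measurable b := hbc.measurable
  have ham : Measurable a :=
    (((Real.measurable_sin.comp hpc.measurable).div
      ((Real.measurable_cos.comp hpc.measurable).const_add 1)).neg).mul hbm
  have hbε : ∀ t ∈ Icc 0 τ, |b t| < ε := by
    intro t ht
    have h1 := hpρ t ht
    have h2 : |D.β (p t)| ≤ B := hB _ (abs_le.1 (h1.trans hρr))
    simp only [b]
    rw [abs_div, div_lt_iff₀ hM', mul_comm ε]
    calc |s * D.β (p t) - k * p t| ≤ |s * D.β (p t)| + |k * p t| := abs_sub _ _
      _ = |s| * |D.β (p t)| + k * |p t| := by rw [abs_mul, abs_mul, abs_of_pos hk]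
      _ ≤ 2 * ρ / τ * B + k * ρ := by gcongr
      _ = Q * ρ := by rw [hQ]; ring
      _ < _ := hQρ
  have hone : ∀ t ∈ Icc 0 τ, |p t| ≤ 1 := fun t ht => (hpρ t ht).trans (hρr.trans hr1)
  have haε : ∀ t ∈ Icc 0 τ, |a t| < ε := by
    intro t ht
    refine lt_of_le_of_lt ?_ (hbε t ht)
    simp only [a]
    rw [abs_mul, abs_neg]
    exact mul_le_of_le_one_left (abs_nonneg _) (abs_sin_div_le (hone t ht)).1
  have hGc : Continuous D.G := continuous_iff_continuousAt.2 fun t => (D.hasDerivAt_G t).continuousAt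
  have hg := D.continuous_g
  have hh₁ := D.continuous_h₁
  have hh₂ := D.continuous_h₂
  have hz := fun t => HasDerivAt.scomp t (D.hasDerivAt_frame_shape u v φ (p t)) (hp t)
  have main := Steers.of_hasDerivAt (F := torqueField k M X Y) (W := W) hτ.le ham hbm haε hbε
    ?_ hz ?_ ?_
  · have e0 : p 0 = α := by simp [p]
    have e1 : p τ = α' := by simp only [p, hs]; field_simp; ring
    simpa only [Function.comp, e0, e1] using main
  · refine Continuous.const_smul (continuous_pi fun i => ?_) s
    fin_cases i <;> simp <;> fun_prop
  · intro t ht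
    exact hW _ (hpρ' t ht)
  · intro t ht
    have hY := D.smul_Y (D.frame u v φ (p t)) ((hpρ t ht).trans hρr)
    have e1 : (D.frame u v φ (p t)) 3 = p t := rfl
    have e2 : (D.frame u v φ (p t)) 2 = φ + D.G (p t) := rfl
    rw [e1, e2] at hY
    have hpos := (abs_sin_div_le (hone t ht)).2
    have c1 : k * p t + M * b t = s * D.β (p t) := by
      simp only [b]; field_simp; ring
    have c2 : Real.sin (p t) * a t + (1 - Real.cos (p t)) * b t = 0 := by
      simp only [a]
      have := Real.sin_sq_add_cos_sq (p t)
      field_simp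
      linear_combination (-b t) * this
    simp only [torqueField, Function.comp, e1]
    rw [c1, c2, mul_zero, zero_smul, add_zero, mul_smul, hY]

theorem exists_steers_rotation {k M ε τ α : ℝ} (hr1 : r ≤ 1) (hM : M ≠ 0) (hk : 0 < k)
    (hτ : 0 < τ) (hα : α ≠ 0) (hαr : |α| ≤ r) (hαε : k * |α| < |M| * ε) :
    ∃ σ > 0, ∀ W : Set (Fin 4 → ℝ), ∀ u v φ φ' : ℝ, |φ' - φ| < σ →
      (∀ ψ ∈ uIcc φ φ', D.frame (u + (D.A₁ α ψ - D.A₁ α φ)) (v + (D.A₂ α ψ - D.A₂ α φ)) ψ α ∈ W) →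
      Steers (torqueField k M X Y) W ε τ (D.frame u v φ α)
        (D.frame (u + (D.A₁ α φ' - D.A₁ α φ)) (v + (D.A₂ α φ' - D.A₂ α φ)) φ' α) := by
  have hM' : 0 < |M| := abs_pos.2 hM
  have hsin : Real.sin α ≠ 0 := by
    have hpi := Real.pi_gt_three
    have h1 := abs_le.1 (hαr.trans hr1)
    exact fun h => hα ((Real.sin_eq_zero_iff_of_lt_of_lt (by linarith) (by linarith)).1 h)
  obtain ⟨htan, hcos⟩ := abs_sin_div_le (hαr.trans hr1)
  let b : ℝ → ℝ := fun s => (s * D.d α - k * α) / M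
  let a : ℝ → ℝ := fun s => s * D.c α / (M * Real.sin α) - Real.sin α / (1 + Real.cos α) * b s
  have hb0 : |b 0| < ε := by
    simp only [b, zero_mul, zero_sub]
    rw [abs_div, abs_neg, abs_mul, abs_of_pos hk, div_lt_iff₀ hM', mul_comm ε]
    exact hαε
  have ha0 : |a 0| < ε := by
    refine lt_of_le_of_lt ?_ hb0
    simp only [a, zero_mul, zero_div, zero_sub]
    rw [abs_neg, abs_mul]
    exact mul_le_of_le_one_left (abs_nonneg _) htan
  have hbc : Continuous b := by fun_prop
  have hac : Continuous a := by fun_prop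
  obtain ⟨σ, hσ, hσab⟩ := Metric.eventually_nhds_iff.1
    ((hac.abs.continuousAt.eventually_lt_const ha0).and
      (hbc.abs.continuousAt.eventually_lt_const hb0))
  refine ⟨σ * τ, by positivity, ?_⟩
  intro W u v φ φ' hφ hW
  set s : ℝ := (φ' - φ) / τ with hs
  have hsσ : dist s 0 < σ := by
    rw [Real.dist_eq, sub_zero, hs, abs_div, abs_of_pos hτ, div_lt_iff₀ hτ]
    exact hφ
  let p : ℝ → ℝ := fun t => φ + s * t
  have hp : ∀ t, HasDerivAt p s t := fun t =>
    (((hasDerivAt_id t).const_mul s).const_add φ).congr_deriv (mul_one s)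
  have hpc : Continuous p := continuous_iff_continuousAt.2 fun t => (hp t).continuousAt
  have hz := fun t => HasDerivAt.scomp t
    (D.hasDerivAt_frame_rotation (u - D.A₁ α φ) (v - D.A₂ α φ) (p t) α) (hp t)
  have main := Steers.of_hasDerivAt (F := torqueField k M X Y) (W := W) (a := fun _ => a s)
    (b := fun _ => b s) hτ.le measurable_const measurable_const
    (fun _ _ => (hσab hsσ).1) (fun _ _ => (hσab hsσ).2) ?_ hz ?_ ?_
  · have e0 : p 0 = φ := by simp [p]
    have e1 : p τ = φ' := by simp only [p, hs]; field_simp; ring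
    simp only [Function.comp, e0, e1] at main
    convert main using 2 <;> ring
  · refine Continuous.const_smul (continuous_pi fun i => ?_) s
    fin_cases i <;> simp <;> fun_prop
  · intro t ht
    have := hW (p t) (by
      have h0 : 0 ≤ t / τ := div_nonneg ht.1 hτ.le
      have h1 : t / τ ≤ 1 := (div_le_one hτ).2 ht.2
      have e : p t = φ + t / τ * (φ' - φ) := by simp only [p, hs]; ring
      rw [e, mem_uIcc]
      rcases le_total φ φ' with h | h
      · left; constructor <;> nlinarith
      · right; constructor <;> nlinarith)
    convert this using 1
    simp only [Function.comp]
    congr 1 <;> ring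
  · intro t ht
    simp only [Function.comp]
    set z := D.frame (u - D.A₁ α φ + D.A₁ α (p t)) (v - D.A₂ α φ + D.A₂ α (p t)) (p t) α with hzdef
    have e1 : z 3 = α := rfl
    have e2 : z 2 = p t + D.G α := rfl
    have hY := D.rotation z (by rw [e1]; exact hαr)
    rw [e1, e2] at hY
    have c1 : k * α + M * b s = s * D.d α := by
      simp only [b]; field_simp; ring
    have c2 : M * (Real.sin α * a s + (1 - Real.cos α) * b s) = s * D.c α := by
      simp only [a]
      have := Real.sin_sq_add_cos_sq α
      field_simp
      linear_combination (-M * b s) * this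
    simp only [torqueField, e1]
    rw [c1, c2, mul_smul, mul_smul, ← hY, smul_add, add_comm]

/-- At frozen `α`, all rotations between angles `σ`-close to `φ₀` are realizable from base points
in a box around `(u₀, v₀)`, and they move the base point by at most `η`. -/
def CanRotate (k M ε τ : ℝ) (W : Set (Fin 4 → ℝ)) (u₀ v₀ φ₀ ρ η σ α : ℝ) : Prop :=
  ∀ φ φ' : ℝ, |φ - φ₀| ≤ σ → |φ' - φ₀| ≤ σ →
    |D.A₁ α φ' - D.A₁ α φ| ≤ η ∧ |D.A₂ α φ' - D.A₂ α φ| ≤ η ∧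
    ∀ u v : ℝ, |u - u₀| ≤ ρ - η → |v - v₀| ≤ ρ - η →
      Steers (torqueField k M X Y) W ε τ (D.frame u v φ α)
        (D.frame (u + (D.A₁ α φ' - D.A₁ α φ)) (v + (D.A₂ α φ' - D.A₂ α φ)) φ' α)

variable {D} in
theorem CanRotate.mono {k M ε τ : ℝ} {W : Set (Fin 4 → ℝ)} {u₀ v₀ φ₀ ρ η σ σ' α : ℝ}
    (h : D.CanRotate k M ε τ W u₀ v₀ φ₀ ρ η σ α) (hσ : σ' ≤ σ) :
    D.CanRotate k M ε τ W u₀ v₀ φ₀ ρ η σ' α :=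
  fun φ φ' h₁ h₂ => h φ φ' (h₁.trans hσ) (h₂.trans hσ)

theorem exists_canRotate {k M ε τ α u₀ v₀ φ₀ ρ η : ℝ} {W : Set (Fin 4 → ℝ)} (hr1 : r ≤ 1)
    (hM : M ≠ 0) (hk : 0 < k) (hτ : 0 < τ) (hα : α ≠ 0) (hαr : |α| ≤ r)
    (hαε : k * |α| < |M| * ε) (hρ : 0 < ρ) (hη : 0 < η) (hαρ : |α| ≤ ρ)
    (hbox : ∀ u v φ α, |u - u₀| ≤ ρ → |v - v₀| ≤ ρ → |φ - φ₀| ≤ ρ → |α| ≤ ρ →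
      D.frame u v φ α ∈ W) :
    ∃ σ > 0, D.CanRotate k M ε τ W u₀ v₀ φ₀ ρ η σ α := by
  obtain ⟨σ₀, hσ₀, H⟩ := D.exists_steers_rotation (ε := ε) hr1 hM hk hτ hα hαr hαε
  set K : ℝ := |D.N₁ α| + |D.N₂ α| with hK
  have hK0 : 0 ≤ K := by positivity
  set σ : ℝ := min ρ (min (σ₀ / 3) (η / (2 * K + 1))) with hσ
  have hσpos : 0 < σ := lt_min hρ (lt_min (by positivity) (by positivity))
  have hσρ : σ ≤ ρ := min_le_left _ _
  have hσ3 : σ ≤ σ₀ / 3 := (min_le_right _ _).trans (min_le_left _ _)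
  have hση : K * (2 * σ) ≤ η := by
    have : σ ≤ η / (2 * K + 1) := (min_le_right _ _).trans (min_le_right _ _)
    rw [le_div_iff₀ (by positivity)] at this
    nlinarith
  have hA : ∀ φ φ' : ℝ, |φ - φ₀| ≤ σ → |φ' - φ₀| ≤ σ →
      |D.A₁ α φ' - D.A₁ α φ| ≤ η ∧ |D.A₂ α φ' - D.A₂ α φ| ≤ η := by
    intro φ φ' h h'
    have hd : |φ' - φ| ≤ 2 * σ := by
      rw [abs_le] at *
      constructor <;> linarith
    have hd' : K * |φ' - φ| ≤ η := (mul_le_mul_of_nonneg_left hd hK0).trans hση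
    exact ⟨(D.abs_A_sub_le α φ' φ).1.trans hd', (D.abs_A_sub_le α φ' φ).2.trans hd'⟩
  refine ⟨σ, hσpos, fun φ φ' h h' => ⟨(hA φ φ' h h').1, (hA φ φ' h h').2, fun u v hu hv => ?_⟩⟩
  refine H W u v φ φ' ?_ ?_
  · rw [abs_le] at h h'
    rw [abs_lt]
    constructor <;> linarith
  · intro ψ hψ
    have hψσ : |ψ - φ₀| ≤ σ := by
      rw [abs_le] at h h' ⊢
      rcases mem_uIcc.1 hψ with h1 | h1 <;> constructor <;> linarith
    obtain ⟨a1, a2⟩ := hA φ ψ h hψσ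
    refine hbox _ _ _ _ ?_ ?_ (hψσ.trans hσρ) hαρ
    · rw [abs_le] at *
      constructor <;> linarith
    · rw [abs_le] at *
      constructor <;> linarith

theorem steers_loop {k M ε τ α₁ α₂ u₀ v₀ φ₀ ρ η σ : ℝ} {W : Set (Fin 4 → ℝ)} (hτ : 0 ≤ τ)
    (hη : 0 ≤ η) (hσρ : σ ≤ ρ)
    (h₁ : D.CanRotate k M ε τ W u₀ v₀ φ₀ ρ η σ α₁)
    (h₂ : D.CanRotate k M ε τ W u₀ v₀ φ₀ ρ η σ α₂)
    (h₁₂ : ∀ u v φ, |u - u₀| ≤ ρ → |v - v₀| ≤ ρ → |φ - φ₀| ≤ ρ →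
      Steers (torqueField k M X Y) W ε τ (D.frame u v φ α₁) (D.frame u v φ α₂) ∧
      Steers (torqueField k M X Y) W ε τ (D.frame u v φ α₂) (D.frame u v φ α₁))
    {φ ψ s : ℝ} (hφ : |φ - φ₀| ≤ σ) (hadd : |ψ + s - φ₀| ≤ σ) (hsub : |ψ - s - φ₀| ≤ σ) (u v : ℝ)
    (hu : |u - u₀| ≤ ρ - 4 * η) (hv : |v - v₀| ≤ ρ - 4 * η) :
    ∃ u' v', u' = u + 2 * Real.sin s * (Real.cos ψ * (D.N₁ α₁ - D.N₁ α₂)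
        - Real.sin ψ * (D.N₂ α₁ - D.N₂ α₂)) ∧
      v' = v + 2 * Real.sin s * (Real.sin ψ * (D.N₁ α₁ - D.N₁ α₂)
        + Real.cos ψ * (D.N₂ α₁ - D.N₂ α₂)) ∧
      |u' - u| ≤ 3 * η ∧ |v' - v| ≤ 3 * η ∧
      Steers (torqueField k M X Y) W ε (5 * τ) (D.frame u v φ α₁) (D.frame u' v' φ α₁) := by
  obtain ⟨a1, a2, r1⟩ := h₁ φ (ψ + s) hφ hadd
  obtain ⟨b1, b2, r2⟩ := h₂ (ψ + s) (ψ - s) hadd hsub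
  obtain ⟨c1, c2, r3⟩ := h₁ (ψ - s) φ hsub hφ
  have e1 := D.A₁_symm_sub α₁ ψ s
  have e2 := D.A₁_symm_sub α₂ ψ s
  have e3 := D.A₂_symm_sub α₁ ψ s
  have e4 := D.A₂_symm_sub α₂ ψ s
  rw [abs_le] at hu hv a1 a2 b1 b2 c1 c2
  set u1 := u + (D.A₁ α₁ (ψ + s) - D.A₁ α₁ φ) with hu1
  set v1 := v + (D.A₂ α₁ (ψ + s) - D.A₂ α₁ φ) with hv1
  set u2 := u1 + (D.A₁ α₂ (ψ - s) - D.A₁ α₂ (ψ + s)) with hu2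
  set v2 := v1 + (D.A₂ α₂ (ψ - s) - D.A₂ α₂ (ψ + s)) with hv2
  refine ⟨u2 + (D.A₁ α₁ φ - D.A₁ α₁ (ψ - s)), v2 + (D.A₂ α₁ φ - D.A₂ α₁ (ψ - s)), ?_, ?_, ?_, ?_,
    ?_⟩
  · linear_combination e1 - e2
  · linear_combination e3 - e4
  · rw [abs_le]; constructor <;> linarith
  · rw [abs_le]; constructor <;> linarith
  have s1 := r1 u v (abs_le.2 ⟨by linarith, by linarith⟩) (abs_le.2 ⟨by linarith, by linarith⟩)
  have s2 := (h₁₂ u1 v1 (ψ + s) (abs_le.2 ⟨by linarith, by linarith⟩)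
    (abs_le.2 ⟨by linarith, by linarith⟩) (hadd.trans hσρ)).1
  have s3 := r2 u1 v1 (abs_le.2 ⟨by linarith, by linarith⟩) (abs_le.2 ⟨by linarith, by linarith⟩)
  have s4 := (h₁₂ u2 v2 (ψ - s) (abs_le.2 ⟨by linarith, by linarith⟩)
    (abs_le.2 ⟨by linarith, by linarith⟩) (hsub.trans hσρ)).2
  have s5 := r3 u2 v2 (abs_le.2 ⟨by linarith, by linarith⟩) (abs_le.2 ⟨by linarith, by linarith⟩)
  have := (((s1.trans hτ hτ s2).trans (by linarith) hτ s3).trans (by linarith) hτ s4).trans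
    (by linarith) hτ s5
  convert this using 1
  ring

theorem exists_small_combination {P Q P' Q' η : ℝ} (hdet : P * Q' - P' * Q ≠ 0) (hη : 0 < η) :
    ∃ ν > 0, ∀ d e : ℝ, |d| ≤ ν → |e| ≤ ν →
      ∃ x y : ℝ, |x| ≤ η ∧ |y| ≤ η ∧ d = x * P + y * P' ∧ e = x * Q + y * Q' := by
  set Δ := P * Q' - P' * Q with hΔ
  have hΔ' : 0 < |Δ| := abs_pos.2 hdet
  set K := |P| + |Q| + |P'| + |Q'| + 1 with hK
  have hKpos : 0 < K := by positivity
  have key : ∀ a b d e : ℝ, |a| + |b| ≤ K → |d| ≤ η * |Δ| / K → |e| ≤ η * |Δ| / K →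
      |(d * a - e * b) / Δ| ≤ η := by
    intro a b d e hab hd he
    rw [abs_div, div_le_iff₀ hΔ']
    calc |d * a - e * b| ≤ |d * a| + |e * b| := abs_sub _ _
      _ = |d| * |a| + |e| * |b| := by rw [abs_mul, abs_mul]
      _ ≤ η * |Δ| / K * |a| + η * |Δ| / K * |b| := by gcongr
      _ = η * |Δ| / K * (|a| + |b|) := by ring
      _ ≤ η * |Δ| / K * K := by gcongr
      _ = η * |Δ| := by field_simp
  refine ⟨η * |Δ| / K, by positivity, fun d e hd he => ?_⟩
  have := abs_nonneg P
  have := abs_nonneg P'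
  have := abs_nonneg Q
  have := abs_nonneg Q'
  refine ⟨(d * Q' - e * P') / Δ, (e * P - d * Q) / Δ, key _ _ _ _ (by linarith) hd he,
    key _ _ _ _ (by linarith) he hd, ?_, ?_⟩
  · field_simp; rw [hΔ]; ring
  · field_simp; rw [hΔ]; ring

theorem exists_sin_eq {σ x : ℝ} (hσ : 0 < σ) (hσ1 : σ ≤ 1) (hx : |x| ≤ 2 * Real.sin σ) :
    ∃ s, |s| ≤ σ ∧ 2 * Real.sin s = x := by
  have hpi := Real.pi_gt_three
  have := Real.sin_le_one σ
  rw [abs_le] at hx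
  refine ⟨Real.arcsin (x / 2), ?_, ?_⟩
  · rw [abs_le]
    constructor
    · rw [Real.le_arcsin_iff_sin_le' ⟨by linarith, by linarith⟩, Real.sin_neg]
      linarith
    · rw [Real.arcsin_le_iff_le_sin' ⟨by linarith, by linarith⟩]
      linarith
  · rw [Real.sin_arcsin (by linarith) (by linarith)]
    ring

theorem continuous_frame : Continuous fun w : ℝ × ℝ × ℝ × ℝ => D.frame w.1 w.2.1 w.2.2.1 w.2.2.2 := by
  have hG : Continuous D.G := continuous_iff_continuousAt.2 fun t => (D.hasDerivAt_G t).continuousAt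
  have h1 : Continuous D.S₁ :=
    continuous_iff_continuousAt.2 fun t => (D.hasDerivAt_S₁ t).continuousAt
  have h2 : Continuous D.S₂ :=
    continuous_iff_continuousAt.2 fun t => (D.hasDerivAt_S₂ t).continuousAt
  refine continuous_pi fun i => ?_
  fin_cases i <;> simp [frame] <;> fun_prop

theorem exists_box {u₀ v₀ φ₀ : ℝ} {W : Set (Fin 4 → ℝ)} (hW : W ∈ nhds (D.frame u₀ v₀ φ₀ 0)) :
    ∃ ρ > 0, ∀ u v φ α, |u - u₀| ≤ ρ → |v - v₀| ≤ ρ → |φ - φ₀| ≤ ρ → |α| ≤ ρ →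
      D.frame u v φ α ∈ W := by
  have := D.continuous_frame.continuousAt (x := (u₀, v₀, φ₀, 0)) hW
  obtain ⟨δ, hδ, H⟩ := Metric.mem_nhds_iff.1 this
  refine ⟨δ / 2, by positivity, fun u v φ α hu hv hφ hα => ?_⟩
  refine H (a := (u, v, φ, α)) ?_
  simp only [Metric.mem_ball, Prod.dist_eq, Real.dist_eq, sub_zero, max_lt_iff]
  refine ⟨?_, ?_, ?_, ?_⟩ <;> linarith

theorem frame_nhds (u₀ v₀ φ₀ : ℝ) {ν : ℝ} (hν : 0 < ν) :
    {z | ∃ u v φ α, z = D.frame u v φ α ∧ |u - u₀| ≤ ν ∧ |v - v₀| ≤ ν ∧ |φ - φ₀| ≤ ν ∧ |α| ≤ ν}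
      ∈ nhds (D.frame u₀ v₀ φ₀ 0) := by
  have hG : Continuous D.G := continuous_iff_continuousAt.2 fun t => (D.hasDerivAt_G t).continuousAt
  have h1 : Continuous D.S₁ :=
    continuous_iff_continuousAt.2 fun t => (D.hasDerivAt_S₁ t).continuousAt
  have h2 : Continuous D.S₂ :=
    continuous_iff_continuousAt.2 fun t => (D.hasDerivAt_S₂ t).continuousAt
  let φ : (Fin 4 → ℝ) → ℝ := fun z => z 2 - D.G (z 3)
  let u : (Fin 4 → ℝ) → ℝ := fun z =>
    z 0 - (Real.cos (φ z) * D.S₁ (z 3) - Real.sin (φ z) * D.S₂ (z 3))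
  let v : (Fin 4 → ℝ) → ℝ := fun z =>
    z 1 - (Real.sin (φ z) * D.S₁ (z 3) + Real.cos (φ z) * D.S₂ (z 3))
  have hφ : Continuous φ := by fun_prop
  have hu : Continuous u := by fun_prop
  have hv : Continuous v := by fun_prop
  have near : ∀ f : (Fin 4 → ℝ) → ℝ, Continuous f → ∀ x, f (D.frame u₀ v₀ φ₀ 0) = x →
      ∀ᶠ z in nhds (D.frame u₀ v₀ φ₀ 0), |f z - x| ≤ ν := by
    intro f hf x hx
    have := Metric.tendsto_nhds.1 (hf.continuousAt (x := D.frame u₀ v₀ φ₀ 0)) ν hν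
    rw [hx] at this
    exact this.mono fun z hz => hz.le
  filter_upwards [near u hu u₀ (by simp [u, frame, D.S₁_zero, D.S₂_zero]),
    near v hv v₀ (by simp [v, frame, D.S₁_zero, D.S₂_zero]),
    near φ hφ φ₀ (by simp [φ, frame, D.G_zero]),
    near (fun z => z 3) (by fun_prop) 0 (by simp [frame])] with z hzu hzv hzφ hzα
  refine ⟨u z, v z, φ z, z 3, ?_, hzu, hzv, hzφ, by simpa using hzα⟩
  ext i
  fin_cases i <;> simp [frame, u, v, φ]

/-- Small-time local steering near an aligned configuration, when the arm of the frozen rotation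
depends on `α` to first order. -/
theorem exists_nhds_steers {k M ε T N' u₀ v₀ φ₀ : ℝ} {W : Set (Fin 4 → ℝ)} (hr : 0 < r)
    (hr1 : r ≤ 1) (hM : M ≠ 0) (hk : 0 < k) (hε : 0 < ε) (hT : 0 < T) (hN : HasDerivAt D.N₁ N' 0)
    (hN' : N' ≠ 0) (hW : W ∈ nhds (D.frame u₀ v₀ φ₀ 0)) :
    ∃ V ∈ nhds (D.frame u₀ v₀ φ₀ 0), ∀ p ∈ V, ∀ q ∈ V,
      Steers (torqueField k M X Y) W ε T p q := by
  set τ : ℝ := T / 13 with hτdef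
  have hτ : 0 < τ := by positivity
  obtain ⟨ρ₁, hρ₁, hρ₁r, hρ₁ε, shape⟩ := D.exists_steers_shape hr hr1 hM hk hε hτ
  obtain ⟨ρ₂, hρ₂, hbox₂⟩ := D.exists_box hW
  set ρ : ℝ := min ρ₁ ρ₂ with hρdef
  have hρ : 0 < ρ := lt_min hρ₁ hρ₂
  have hρ1 : ρ ≤ ρ₁ := min_le_left _ _
  have hρ2 : ρ ≤ ρ₂ := min_le_right _ _
  have hbox : ∀ u v φ α, |u - u₀| ≤ ρ → |v - v₀| ≤ ρ → |φ - φ₀| ≤ ρ → |α| ≤ ρ →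
      D.frame u v φ α ∈ W := fun u v φ α h1 h2 h3 h4 =>
    hbox₂ u v φ α (h1.trans hρ2) (h2.trans hρ2) (h3.trans hρ2) (h4.trans hρ2)
  have small : ∀ c : ℝ, ∃ α, α ≠ 0 ∧ |α| ≤ ρ ∧ D.N₁ α ≠ c := by
    intro c
    have h1 : ∀ᶠ α : ℝ in nhdsWithin 0 {0}ᶜ, |α| < ρ :=
      nhdsWithin_le_nhds (continuous_abs.continuousAt.eventually_lt_const (by simpa using hρ))
    have h2 : ∀ᶠ α : ℝ in nhdsWithin 0 {0}ᶜ, α ≠ 0 := eventually_mem_nhdsWithin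
    obtain ⟨α, ⟨h3, h4⟩, h5⟩ := ((h2.and h1).and (hN.eventually_ne (c := c) hN')).exists
    exact ⟨α, h3, h4.le, h5⟩
  obtain ⟨α₁, hα₁, hα₁ρ, -⟩ := small 0
  obtain ⟨α₂, hα₂, hα₂ρ, hne⟩ := small (D.N₁ α₁)
  have lt_ε : ∀ α, |α| ≤ ρ → k * |α| < |M| * ε := fun α h =>
    (mul_le_mul_of_nonneg_left (h.trans hρ1) hk.le).trans_lt hρ₁ε
  set η : ℝ := ρ / 10 with hη
  have hηpos : 0 < η := by positivity
  obtain ⟨σ₁, hσ₁, rot₁⟩ := D.exists_canRotate (ε := ε) (η := η) hr1 hM hk hτ hα₁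
    (hα₁ρ.trans (hρ1.trans hρ₁r)) (lt_ε _ hα₁ρ) hρ hηpos hα₁ρ hbox
  obtain ⟨σ₂, hσ₂, rot₂⟩ := D.exists_canRotate (ε := ε) (η := η) hr1 hM hk hτ hα₂
    (hα₂ρ.trans (hρ1.trans hρ₁r)) (lt_ε _ hα₂ρ) hρ hηpos hα₂ρ hbox
  set σ : ℝ := min ρ (min 1 (min σ₁ σ₂)) with hσdef
  have hσ : 0 < σ := lt_min hρ (lt_min one_pos (lt_min hσ₁ hσ₂))
  have hσρ : σ ≤ ρ := min_le_left _ _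
  have hσ1 : σ ≤ 1 := (min_le_right _ _).trans (min_le_left _ _)
  replace rot₁ := rot₁.mono (σ' := σ) ((min_le_right _ _).trans
    ((min_le_right _ _).trans (min_le_left _ _)))
  replace rot₂ := rot₂.mono (σ' := σ) ((min_le_right _ _).trans
    ((min_le_right _ _).trans (min_le_right _ _)))
  have shape' : ∀ u v φ α α', |u - u₀| ≤ ρ → |v - v₀| ≤ ρ → |φ - φ₀| ≤ ρ → |α| ≤ ρ → |α'| ≤ ρ →
      Steers (torqueField k M X Y) W ε τ (D.frame u v φ α) (D.frame u v φ α') :=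
    fun u v φ α α' hu hv hφ hα hα' => shape W ρ hρ1 u v φ α α' hα hα'
      fun s hs => hbox u v φ s hu hv hφ hs
  have loop := fun {φ ψ s : ℝ} => D.steers_loop (φ := φ) (ψ := ψ) (s := s) hτ.le hηpos.le hσρ
    rot₁ rot₂ fun u v φ hu hv hφ => ⟨shape' u v φ α₁ α₂ hu hv hφ hα₁ρ hα₂ρ,
      shape' u v φ α₂ α₁ hu hv hφ hα₂ρ hα₁ρ⟩
  have hsin : 0 < Real.sin (σ / 2) :=
    Real.sin_pos_of_pos_of_le_one (by positivity) (by linarith)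
  set n₁ := D.N₁ α₁ - D.N₁ α₂ with hn₁
  set n₂ := D.N₂ α₁ - D.N₂ α₂ with hn₂
  have hn₁0 : n₁ ≠ 0 := sub_ne_zero.2 hne.symm
  have hdet : (Real.cos φ₀ * n₁ - Real.sin φ₀ * n₂) *
        (Real.sin (φ₀ + σ / 2) * n₁ + Real.cos (φ₀ + σ / 2) * n₂) -
      (Real.cos (φ₀ + σ / 2) * n₁ - Real.sin (φ₀ + σ / 2) * n₂) *
        (Real.sin φ₀ * n₁ + Real.cos φ₀ * n₂) ≠ 0 := by
    have : (Real.cos φ₀ * n₁ - Real.sin φ₀ * n₂) *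
        (Real.sin (φ₀ + σ / 2) * n₁ + Real.cos (φ₀ + σ / 2) * n₂) -
      (Real.cos (φ₀ + σ / 2) * n₁ - Real.sin (φ₀ + σ / 2) * n₂) *
        (Real.sin φ₀ * n₁ + Real.cos φ₀ * n₂) = (n₁ ^ 2 + n₂ ^ 2) * Real.sin (σ / 2) := by
      rw [Real.sin_add, Real.cos_add]
      linear_combination (n₁ ^ 2 + n₂ ^ 2) * Real.sin (σ / 2) * Real.sin_sq_add_cos_sq φ₀
    rw [this]
    positivity
  obtain ⟨ν₀, hν₀, solve⟩ := exists_small_combination hdet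
    (η := 2 * Real.sin (σ / 2)) (by positivity)
  set K : ℝ := |D.N₁ α₁| + |D.N₂ α₁| with hK
  have hK0 : 0 ≤ K := by positivity
  set ν : ℝ := min (min η σ) (ν₀ / (2 + 2 * K)) with hν
  have hνpos : 0 < ν := lt_min (lt_min hηpos hσ) (by positivity)
  have hνη : ν ≤ η := (min_le_left _ _).trans (min_le_left _ _)
  have hνσ : ν ≤ σ := (min_le_left _ _).trans (min_le_right _ _)
  have hνν₀ : 2 * ν + K * (2 * ν) ≤ ν₀ := by
    have : ν ≤ ν₀ / (2 + 2 * K) := min_le_right _ _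
    rw [le_div_iff₀ (by positivity)] at this
    linarith
  refine ⟨_, D.frame_nhds u₀ v₀ φ₀ hνpos, ?_⟩
  rintro _ ⟨ui, vi, φi, αi, rfl, hui, hvi, hφi, hαi⟩ _ ⟨uf, vf, φf, αf, rfl, huf, hvf, hφf, hαf⟩
  obtain ⟨a1, a2, rot⟩ := rot₁ φi φf (hφi.trans hνσ) (hφf.trans hνσ)
  have hφd : |φf - φi| ≤ 2 * ν := by
    rw [abs_le] at *
    constructor <;> linarith
  obtain ⟨k1, k2⟩ := D.abs_A_sub_le α₁ φf φi
  have hKν : K * |φf - φi| ≤ K * (2 * ν) := mul_le_mul_of_nonneg_left hφd hK0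
  replace k1 := k1.trans hKν
  replace k2 := k2.trans hKν
  have hu' := abs_le.1 hui
  have hv' := abs_le.1 hvi
  have huf' := abs_le.1 huf
  have hvf' := abs_le.1 hvf
  rw [abs_le] at a1 a2 k1 k2
  set u1 := ui + (D.A₁ α₁ φf - D.A₁ α₁ φi) with hu1
  set v1 := vi + (D.A₂ α₁ φf - D.A₂ α₁ φi) with hv1
  obtain ⟨x, y, hx, hy, ex, ey⟩ := solve (uf - u1) (vf - v1)
    (abs_le.2 ⟨by linarith, by linarith⟩) (abs_le.2 ⟨by linarith, by linarith⟩)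
  obtain ⟨s, hs, rfl⟩ := exists_sin_eq (by positivity) (by linarith) hx
  obtain ⟨s', hs', rfl⟩ := exists_sin_eq (by positivity) (by linarith) hy
  rw [abs_le] at hs hs'
  obtain ⟨u2, v2, eu2, ev2, bu2, bv2, st2⟩ := loop (φ := φf) (ψ := φ₀) (s := s) (hφf.trans hνσ)
    (abs_le.2 ⟨by linarith, by linarith⟩) (abs_le.2 ⟨by linarith, by linarith⟩) u1 v1
    (abs_le.2 ⟨by linarith, by linarith⟩) (abs_le.2 ⟨by linarith, by linarith⟩)
  rw [abs_le] at bu2 bv2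
  obtain ⟨u3, v3, eu3, ev3, -, -, st3⟩ := loop (φ := φf) (ψ := φ₀ + σ / 2) (s := s')
    (hφf.trans hνσ)
    (abs_le.2 ⟨by linarith, by linarith⟩) (abs_le.2 ⟨by linarith, by linarith⟩) u2 v2
    (abs_le.2 ⟨by linarith, by linarith⟩) (abs_le.2 ⟨by linarith, by linarith⟩)
  have eu : u3 = uf := by rw [eu3, eu2]; linarith
  have ev : v3 = vf := by rw [ev3, ev2]; linarith
  rw [eu, ev] at st3
  have st0 := shape' ui vi φi αi α₁ (abs_le.2 ⟨by linarith, by linarith⟩)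
    (abs_le.2 ⟨by linarith, by linarith⟩) (hφi.trans (hνσ.trans hσρ))
    (hαi.trans (hνσ.trans hσρ)) hα₁ρ
  have st1 := rot ui vi (abs_le.2 ⟨by linarith, by linarith⟩)
    (abs_le.2 ⟨by linarith, by linarith⟩)
  have st4 := shape' uf vf φf α₁ αf (abs_le.2 ⟨by linarith, by linarith⟩)
    (abs_le.2 ⟨by linarith, by linarith⟩) (hφf.trans (hνσ.trans hσρ)) hα₁ρ
    (hαf.trans (hνσ.trans hσρ))
  have := (((st0.trans hτ.le hτ.le st1).trans (by linarith) (by linarith) st2).trans (by linarith)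
    (by linarith) st3).trans (by linarith) hτ.le st4
  convert this using 1
  rw [hτdef]
  ring

end ShapeChart

section Swimmer

variable {l1 l2 x1 x2 e1 e2 : ℝ}

theorem continuous_Emat : Continuous (Emat l1 l2 x1 x2 e1 e2) := by
  refine continuous_matrix fun i j => ?_
  fin_cases i <;> fin_cases j <;> simp [Emat] <;> fun_prop

theorem det_Emat_zero : (Emat l1 l2 x1 x2 e1 e2 0).det =
    -((x1 * l1 + x2 * l2) * (e1 * e2 * l1 ^ 3 * l2 ^ 3 * (e1 * l1 + e2 * l2) / 36)) := by
  simp [Emat, Matrix.det_succ_row_zero, Fin.sum_univ_succ, Fin.succAbove]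
  ring

theorem Emat_inv_entry_continuousAt {a : ℝ} (h : (Emat l1 l2 x1 x2 e1 e2 a).det ≠ 0)
    (i j : Fin 4) : ContinuousAt (fun a => (Emat l1 l2 x1 x2 e1 e2 a)⁻¹ i j) a := by
  simp only [Matrix.inv_def, Ring.inverse_eq_inv', Matrix.smul_apply, smul_eq_mul]
  have hE := continuous_Emat (l1 := l1) (l2 := l2) (x1 := x1) (x2 := x2) (e1 := e1) (e2 := e2)
  exact (hE.matrix_det.continuousAt.inv₀ h).mul (hE.matrix_adjugate.matrix_elem i j).continuousAt

/-- The torque balances at `α = 0` of the last column of the inverse. -/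
theorem Emat_inv_col_zero (h : (Emat l1 l2 x1 x2 e1 e2 0).det ≠ 0) {b : Fin 4 → ℝ}
    (hb : b = fun i => (Emat l1 l2 x1 x2 e1 e2 0)⁻¹ i 3) :
    -(e1 * l1 + e2 * l2) * b 1 + (1/2) * e1 * l1 * (l1 + l2) * b 2 + (1/2) * e1 * l1 ^ 2 * b 3 = 0 ∧
    (1/2) * (e1 * l1 ^ 2 - e2 * l2 ^ 2) * b 1
      - (e1 * l1 ^ 2 * ((1/4) * l2 + (1/3) * l1) + e2 * l2 ^ 2 * ((1/12) * l2)) * b 2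
      - e1 * l1 ^ 2 * ((1/3) * l1) * b 3 = 0 ∧
    -(1/2) * (e2 * l2 ^ 2) * b 1 - e2 * l2 ^ 2 * ((1/12) * l2) * b 2 = 1 := by
  have hmul : Emat l1 l2 x1 x2 e1 e2 0 * (Emat l1 l2 x1 x2 e1 e2 0)⁻¹ = 1 :=
    Matrix.mul_nonsing_inv _ (isUnit_iff_ne_zero.2 h)
  have row : ∀ i, ∑ j, Emat l1 l2 x1 x2 e1 e2 0 i j * b j = (1 : Matrix (Fin 4) (Fin 4) ℝ) i 3 := by
    intro i
    rw [← hmul, Matrix.mul_apply, hb]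
  have r1 := row 1
  have r2 := row 2
  have r3 := row 3
  simp [Fin.sum_univ_four, Emat] at r1 r2 r3
  refine ⟨?_, ?_, ?_⟩ <;> linarith

theorem Emat_inv_zero_ne (hl1 : 0 < l1) (hl2 : 0 < l2) (he1 : 0 < e1) (he2 : 0 < e2)
    (h : (Emat l1 l2 x1 x2 e1 e2 0).det ≠ 0) : (Emat l1 l2 x1 x2 e1 e2 0)⁻¹ 3 3 ≠ 0 := by
  intro h3
  obtain ⟨r1, r2, r3⟩ := Emat_inv_col_zero h rfl
  simp only [h3] at r1 r2 r3
  set b1 := (Emat l1 l2 x1 x2 e1 e2 0)⁻¹ 1 3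
  set b2 := (Emat l1 l2 x1 x2 e1 e2 0)⁻¹ 2 3
  have hdet : 0 < e1 ^ 2 * l1 ^ 4 / 12 + e1 * e2 * l1 ^ 3 * l2 / 3
      + e1 * e2 * l1 ^ 2 * l2 ^ 2 / 2 + e1 * e2 * l1 * l2 ^ 3 / 3 + e2 ^ 2 * l2 ^ 4 / 12 := by
    positivity
  have hb2 : b2 * (e1 ^ 2 * l1 ^ 4 / 12 + e1 * e2 * l1 ^ 3 * l2 / 3
      + e1 * e2 * l1 ^ 2 * l2 ^ 2 / 2 + e1 * e2 * l1 * l2 ^ 3 / 3 + e2 ^ 2 * l2 ^ 4 / 12) = 0 := by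
    linear_combination (-(1/2) * (e1 * l1 ^ 2 - e2 * l2 ^ 2)) * r1 - (e1 * l1 + e2 * l2) * r2
  have hb2' : b2 = 0 := (mul_eq_zero.1 hb2).resolve_right hdet.ne'
  have hA : 0 < e1 * l1 + e2 * l2 := by positivity
  have hb1 : (e1 * l1 + e2 * l2) * b1 = 0 := by rw [hb2'] at r1; linarith
  have hb1' : b1 = 0 := (mul_eq_zero.1 hb1).resolve_left hA.ne'
  rw [hb1', hb2'] at r3
  norm_num at r3

theorem exists_Emat_radius (hl1 : 0 < l1) (hl2 : 0 < l2) (he1 : 0 < e1) (he2 : 0 < e2)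
    (h : (Emat l1 l2 x1 x2 e1 e2 0).det ≠ 0) :
    ∃ r > 0, r ≤ 1 ∧ ∀ a, |a| ≤ r → (Emat l1 l2 x1 x2 e1 e2 a).det ≠ 0 ∧
      (Emat l1 l2 x1 x2 e1 e2 a)⁻¹ 3 3 ≠ 0 := by
  have hE := continuous_Emat (l1 := l1) (l2 := l2) (x1 := x1) (x2 := x2) (e1 := e1) (e2 := e2)
  obtain ⟨δ, hδ, H⟩ := Metric.eventually_nhds_iff.1
    ((hE.matrix_det.continuousAt.eventually_ne h).and
      ((Emat_inv_entry_continuousAt h 3 3).eventually_ne (Emat_inv_zero_ne hl1 hl2 he1 he2 h)))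
  refine ⟨min 1 (δ / 2), lt_min one_pos (by positivity), min_le_left _ _, fun a ha => ?_⟩
  refine H ?_
  rw [Real.dist_eq, sub_zero]
  have := min_le_right (1 : ℝ) (δ / 2)
  linarith

theorem Rtil_mulVec (θ : ℝ) (w : Fin 4 → ℝ) : (Rtil θ).mulVec w =
    ![Real.cos θ * w 0 - Real.sin θ * w 1, Real.sin θ * w 0 + Real.cos θ * w 1, w 2, w 3] := by
  ext i
  fin_cases i <;> simp [Rtil, Matrix.mulVec, dotProduct, Fin.sum_univ_four]
  ring

theorem X3_X4_combination {w : Fin 4 → ℝ} {z : Fin 4 → ℝ} {c d : ℝ}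
    (h : (Emat l1 l2 x1 x2 e1 e2 (z 3)).det ≠ 0)
    (hw : (Emat l1 l2 x1 x2 e1 e2 (z 3)).mulVec w = ![0, 0, c, d]) :
    c • X3 l1 l2 x1 x2 e1 e2 z + d • X4 l1 l2 x1 x2 e1 e2 z = (Rtil (z 2)).mulVec w := by
  have hinv : w = (Emat l1 l2 x1 x2 e1 e2 (z 3))⁻¹.mulVec ![0, 0, c, d] := by
    rw [← hw, Matrix.mulVec_mulVec, Matrix.nonsing_inv_mul _ (isUnit_iff_ne_zero.2 h),
      Matrix.one_mulVec]
  have hw' : w = c • (fun i => (Emat l1 l2 x1 x2 e1 e2 (z 3))⁻¹ i 2)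
      + d • fun i => (Emat l1 l2 x1 x2 e1 e2 (z 3))⁻¹ i 3 := by
    rw [hinv]
    ext i
    simp [Matrix.mulVec, dotProduct, Fin.sum_univ_four]
    ring
  rw [hw', Matrix.mulVec_add, Matrix.mulVec_smul, Matrix.mulVec_smul]
  rfl

/-- Determinant of the translational drag block. -/
noncomputable def dragDet (l1 l2 x1 x2 e1 e2 a : ℝ) : ℝ :=
  (x1 * l1 + x2 * l2) * (e1 * l1 + e2 * l2) * Real.cos a ^ 2
    + (x1 * l1 + e2 * l2) * (e1 * l1 + x2 * l2) * Real.sin a ^ 2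

/-- First component of the translation velocity forced by a unit rotation at frozen `α`. -/
noncomputable def armX (l1 l2 x1 x2 e1 e2 a : ℝ) : ℝ :=
  ((e1 * l1 + e2 * l2) * Real.cos a * ((1/2) * x1 * l1 * l2 * Real.sin a)
    - (x1 * l1 + e2 * l2) * Real.sin a * ((1/2) * e1 * l1 * (l1 + l2 * Real.cos a)))
    / dragDet l1 l2 x1 x2 e1 e2 a

/-- Second component of the translation velocity forced by a unit rotation at frozen `α`. -/
noncomputable def armY (l1 l2 x1 x2 e1 e2 a : ℝ) : ℝ :=
  ((x1 * l1 + x2 * l2) * Real.cos a * ((1/2) * e1 * l1 * (l1 + l2 * Real.cos a))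
    + (e1 * l1 + x2 * l2) * Real.sin a * ((1/2) * x1 * l1 * l2 * Real.sin a))
    / dragDet l1 l2 x1 x2 e1 e2 a

theorem dragDet_pos (hl1 : 0 < l1) (hl2 : 0 < l2) (hx1 : 0 < x1) (hx2 : 0 < x2) (he1 : 0 < e1)
    (he2 : 0 < e2) (a : ℝ) : 0 < dragDet l1 l2 x1 x2 e1 e2 a := by
  unfold dragDet
  have h1 : 0 < (x1 * l1 + x2 * l2) * (e1 * l1 + e2 * l2) := by positivity
  have h2 : 0 < (x1 * l1 + e2 * l2) * (e1 * l1 + x2 * l2) := by positivity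
  have := Real.sin_sq_add_cos_sq a
  rcases (sq_nonneg (Real.cos a)).eq_or_lt with hc | hc
  · rw [← hc] at this ⊢
    have hs : Real.sin a ^ 2 = 1 := by linarith
    rw [hs]; linarith
  · have h3 := mul_pos h1 hc
    have h4 := mul_nonneg h2.le (sq_nonneg (Real.sin a))
    linarith

theorem Emat_mulVec_arm (hl1 : 0 < l1) (hl2 : 0 < l2) (hx1 : 0 < x1) (hx2 : 0 < x2) (he1 : 0 < e1)
    (he2 : 0 < e2) (a : ℝ) : (Emat l1 l2 x1 x2 e1 e2 a).mulVec
      ![armX l1 l2 x1 x2 e1 e2 a, armY l1 l2 x1 x2 e1 e2 a, 1, 0] =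
    ![0, 0,
      (Emat l1 l2 x1 x2 e1 e2 a).mulVec
        ![armX l1 l2 x1 x2 e1 e2 a, armY l1 l2 x1 x2 e1 e2 a, 1, 0] 2,
      (Emat l1 l2 x1 x2 e1 e2 a).mulVec
        ![armX l1 l2 x1 x2 e1 e2 a, armY l1 l2 x1 x2 e1 e2 a, 1, 0] 3] := by
  have hD := (dragDet_pos hl1 hl2 hx1 hx2 he1 he2 a).ne'
  ext i
  fin_cases i
  · simp [Matrix.mulVec, dotProduct, Fin.sum_univ_four, Emat, armX, armY]
    field_simp
    simp only [dragDet]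
    ring
  · simp [Matrix.mulVec, dotProduct, Fin.sum_univ_four, Emat, armX, armY]
    field_simp
    simp only [dragDet]
    ring
  · rfl
  · rfl

theorem hasDerivAt_dragDet_zero : HasDerivAt (dragDet l1 l2 x1 x2 e1 e2) 0 0 := by
  have hs := Real.hasDerivAt_sin 0
  have hc := Real.hasDerivAt_cos 0
  refine (((hc.pow 2).const_mul ((x1 * l1 + x2 * l2) * (e1 * l1 + e2 * l2))).add
    ((hs.pow 2).const_mul ((x1 * l1 + e2 * l2) * (e1 * l1 + x2 * l2)))).congr_deriv ?_
  simp

theorem hasDerivAt_armX_zero (hl1 : 0 < l1) (hl2 : 0 < l2) (hx1 : 0 < x1) (hx2 : 0 < x2)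
    (he1 : 0 < e1) (he2 : 0 < e2) : HasDerivAt (armX l1 l2 x1 x2 e1 e2)
      (((e1 * l1 + e2 * l2) * ((1/2) * x1 * l1 * l2)
        - (x1 * l1 + e2 * l2) * ((1/2) * e1 * l1 * (l1 + l2)))
        / ((x1 * l1 + x2 * l2) * (e1 * l1 + e2 * l2))) 0 := by
  have hs := Real.hasDerivAt_sin 0
  have hc := Real.hasDerivAt_cos 0
  have hD := dragDet_pos hl1 hl2 hx1 hx2 he1 he2 0
  have hD0 : dragDet l1 l2 x1 x2 e1 e2 0 = (x1 * l1 + x2 * l2) * (e1 * l1 + e2 * l2) := by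
    simp [dragDet]
  refine ((((hc.const_mul (e1 * l1 + e2 * l2)).mul (hs.const_mul ((1/2) * x1 * l1 * l2))).sub
    ((hs.const_mul (x1 * l1 + e2 * l2)).mul
      (((hc.const_mul l2).const_add l1).const_mul ((1/2) * e1 * l1)))).div
    hasDerivAt_dragDet_zero hD.ne').congr_deriv ?_
  rw [hD0]
  have : (x1 * l1 + x2 * l2) * (e1 * l1 + e2 * l2) ≠ 0 := by positivity
  simp
  field_simp

theorem differentiableAt_armY_zero (hl1 : 0 < l1) (hl2 : 0 < l2) (hx1 : 0 < x1) (hx2 : 0 < x2)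
    (he1 : 0 < e1) (he2 : 0 < e2) : DifferentiableAt ℝ (armY l1 l2 x1 x2 e1 e2) 0 := by
  have hD := dragDet_pos hl1 hl2 hx1 hx2 he1 he2 0
  unfold armY
  refine DifferentiableAt.div ?_ hasDerivAt_dragDet_zero.differentiableAt hD.ne'
  fun_prop

/-- Entries of the last column of the inverse, with the angle clamped to `[-r, r]`. -/
noncomputable def clampedCol (l1 l2 x1 x2 e1 e2 r : ℝ) (i : Fin 4) (a : ℝ) : ℝ :=
  (Emat l1 l2 x1 x2 e1 e2 (max (-r) (min r a)))⁻¹ i 3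

theorem clampedCol_of_abs_le {r a : ℝ} (ha : |a| ≤ r) (i : Fin 4) :
    clampedCol l1 l2 x1 x2 e1 e2 r i a = (Emat l1 l2 x1 x2 e1 e2 a)⁻¹ i 3 := by
  rw [abs_le] at ha
  rw [clampedCol, min_eq_right ha.2, max_eq_right ha.1]

theorem abs_clamp_le {r : ℝ} (hr : 0 ≤ r) (a : ℝ) : |max (-r) (min r a)| ≤ r :=
  abs_le.2 ⟨le_max_left _ _, max_le (by linarith) (min_le_left _ _)⟩

theorem continuous_clampedCol {r : ℝ} (hr : 0 ≤ r)
    (h : ∀ a, |a| ≤ r → (Emat l1 l2 x1 x2 e1 e2 a).det ≠ 0) (i : Fin 4) :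
    Continuous (clampedCol l1 l2 x1 x2 e1 e2 r i) := by
  refine continuous_iff_continuousAt.2 fun a => ?_
  exact ContinuousAt.comp (f := fun a => max (-r) (min r a))
    (g := fun a => (Emat l1 l2 x1 x2 e1 e2 a)⁻¹ i 3)
    (Emat_inv_entry_continuousAt (h _ (abs_clamp_le hr a)) i 3)
    (by fun_prop)

theorem hasDerivAt_primitive {f : ℝ → ℝ} (hf : Continuous f) (a : ℝ) :
    HasDerivAt (fun x => ∫ t in (0:ℝ)..x, f t) (f a) a :=
  (hf.integral_hasStrictDerivAt 0 a).hasDerivAt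

theorem exists_shapeChart (hl1 : 0 < l1) (hl2 : 0 < l2) (hx1 : 0 < x1) (hx2 : 0 < x2)
    (he1 : 0 < e1) (he2 : 0 < e2) {r : ℝ} (hr : 0 < r)
    (H : ∀ a, |a| ≤ r → (Emat l1 l2 x1 x2 e1 e2 a).det ≠ 0 ∧
      (Emat l1 l2 x1 x2 e1 e2 a)⁻¹ 3 3 ≠ 0) :
    ∃ D : ShapeChart (X3 l1 l2 x1 x2 e1 e2) (X4 l1 l2 x1 x2 e1 e2) r,
      D.p₁ = armX l1 l2 x1 x2 e1 e2 ∧ D.p₂ = armY l1 l2 x1 x2 e1 e2 ∧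
      D.g 0 = (Emat l1 l2 x1 x2 e1 e2 0)⁻¹ 2 3 / (Emat l1 l2 x1 x2 e1 e2 0)⁻¹ 3 3 ∧
      D.h₂ 0 = (Emat l1 l2 x1 x2 e1 e2 0)⁻¹ 1 3 / (Emat l1 l2 x1 x2 e1 e2 0)⁻¹ 3 3 := by
  have hb := continuous_clampedCol hr.le fun a ha => (H a ha).1
  have hb3 : ∀ a, clampedCol l1 l2 x1 x2 e1 e2 r 3 a ≠ 0 := fun a =>
    (H _ (abs_clamp_le hr.le a)).2
  set b := clampedCol l1 l2 x1 x2 e1 e2 r with hbdef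
  have hq : ∀ i, Continuous fun a => b i a / b 3 a := fun i => (hb i).div (hb 3) hb3
  let G : ℝ → ℝ := fun x => ∫ t in (0:ℝ)..x, b 2 t / b 3 t
  have hG : ∀ a, HasDerivAt G (b 2 a / b 3 a) a := hasDerivAt_primitive (hq 2)
  have hGc : Continuous G := continuous_iff_continuousAt.2 fun t => (hG t).continuousAt
  have hq0 := hq 0
  have hq1 := hq 1
  have h0 : |(0:ℝ)| ≤ r := by simpa using hr.le
  refine ⟨{
    β := fun a => (b 3 a)⁻¹
    g := fun a => b 2 a / b 3 a
    h₁ := fun a => b 0 a / b 3 a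
    h₂ := fun a => b 1 a / b 3 a
    p₁ := armX l1 l2 x1 x2 e1 e2
    p₂ := armY l1 l2 x1 x2 e1 e2
    c := fun a => (Emat l1 l2 x1 x2 e1 e2 a).mulVec
        ![armX l1 l2 x1 x2 e1 e2 a, armY l1 l2 x1 x2 e1 e2 a, 1, 0] 2
    d := fun a => (Emat l1 l2 x1 x2 e1 e2 a).mulVec
        ![armX l1 l2 x1 x2 e1 e2 a, armY l1 l2 x1 x2 e1 e2 a, 1, 0] 3
    G := G
    S₁ := fun x => ∫ t in (0:ℝ)..x,
      (Real.cos (G t) * (b 0 t / b 3 t) - Real.sin (G t) * (b 1 t / b 3 t))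
    S₂ := fun x => ∫ t in (0:ℝ)..x,
      (Real.sin (G t) * (b 0 t / b 3 t) + Real.cos (G t) * (b 1 t / b 3 t))
    continuous_β := (hb 3).inv₀ hb3
    continuous_g := hq 2
    continuous_h₁ := hq 0
    continuous_h₂ := hq 1
    hasDerivAt_G := hG
    hasDerivAt_S₁ := hasDerivAt_primitive (by fun_prop)
    hasDerivAt_S₂ := hasDerivAt_primitive (by fun_prop)
    G_zero := intervalIntegral.integral_same
    S₁_zero := intervalIntegral.integral_same
    S₂_zero := intervalIntegral.integral_same
    smul_Y := ?_
    rotation := ?_ }, rfl, rfl, ?_, ?_⟩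
  · intro z hz
    have h3 := (H _ hz).2
    simp only [hbdef, clampedCol_of_abs_le hz, X4, Rtil_mulVec]
    ext i
    fin_cases i <;> simp <;> field_simp
  · intro z hz
    rw [X3_X4_combination (H _ hz).1 (Emat_mulVec_arm hl1 hl2 hx1 hx2 he1 he2 (z 3)), Rtil_mulVec]
    simp
  · simp only [hbdef, clampedCol_of_abs_le h0]
  · simp only [hbdef, clampedCol_of_abs_le h0]

/-- The arm of the frozen rotation varies to first order at `α = 0` as soon as the drag of one
segment is anisotropic. -/
theorem exists_hasDerivAt_N₁ (hl1 : 0 < l1) (hl2 : 0 < l2) (hx1 : 0 < x1) (hx2 : 0 < x2)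
    (he1 : 0 < e1) (he2 : 0 < e2) (hne : (e1 - x1, e2 - x2) ≠ (0, 0)) (h1 : x1 ≤ e1)
    (h2 : x2 ≤ e2) {r : ℝ} (h : (Emat l1 l2 x1 x2 e1 e2 0).det ≠ 0)
    (D : ShapeChart (X3 l1 l2 x1 x2 e1 e2) (X4 l1 l2 x1 x2 e1 e2) r)
    (hp₁ : D.p₁ = armX l1 l2 x1 x2 e1 e2) (hp₂ : D.p₂ = armY l1 l2 x1 x2 e1 e2)
    (hg : D.g 0 = (Emat l1 l2 x1 x2 e1 e2 0)⁻¹ 2 3 / (Emat l1 l2 x1 x2 e1 e2 0)⁻¹ 3 3)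
    (hh₂ : D.h₂ 0 = (Emat l1 l2 x1 x2 e1 e2 0)⁻¹ 1 3 / (Emat l1 l2 x1 x2 e1 e2 0)⁻¹ 3 3) :
    ∃ N', HasDerivAt D.N₁ N' 0 ∧ N' ≠ 0 := by
  have hb3 := Emat_inv_zero_ne hl1 hl2 he1 he2 h
  obtain ⟨r1, -, -⟩ := Emat_inv_col_zero h rfl
  have hA : 0 < e1 * l1 + e2 * l2 := by positivity
  have hX : 0 < x1 * l1 + x2 * l2 := by positivity
  have hY : armY l1 l2 x1 x2 e1 e2 0 = (1/2) * e1 * l1 * (l1 + l2) / (e1 * l1 + e2 * l2) := by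
    simp [armY, dragDet]
    field_simp
  have bal : D.h₂ 0 - D.g 0 * armY l1 l2 x1 x2 e1 e2 0
      = (1/2) * e1 * l1 ^ 2 / (e1 * l1 + e2 * l2) := by
    rw [hY, hg, hh₂]
    field_simp
    linear_combination (-2) * r1
  have dX := hasDerivAt_armX_zero hl1 hl2 hx1 hx2 he1 he2
  have dY := (differentiableAt_armY_zero hl1 hl2 hx1 hx2 he1 he2).hasDerivAt
  rw [← hp₁] at dX
  rw [← hp₂] at dY bal
  have dG := D.hasDerivAt_G 0
  refine ⟨_, ((dG.cos.mul dX).sub (dG.sin.mul dY)).add (D.hasDerivAt_S₂ 0), ?_⟩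
  have hpos : 0 < e2 * l2 * (e1 - x1) + e1 * l1 * (e2 - x2) := by
    have g1 : 0 ≤ e2 * l2 * (e1 - x1) := mul_nonneg (by positivity) (by linarith)
    have g2 : 0 ≤ e1 * l1 * (e2 - x2) := mul_nonneg (by positivity) (by linarith)
    rcases h1.eq_or_lt with q1 | q1
    · rcases h2.eq_or_lt with q2 | q2
      · exact absurd (by rw [q1, q2, sub_self, sub_self]) hne
      · have : 0 < e1 * l1 * (e2 - x2) := mul_pos (by positivity) (by linarith)
        linarith
    · have : 0 < e2 * l2 * (e1 - x1) := mul_pos (by positivity) (by linarith)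
      linarith
  apply ne_of_lt
  simp only [D.G_zero, Real.cos_zero, Real.sin_zero]
  calc _ = ((e1 * l1 + e2 * l2) * ((1/2) * x1 * l1 * l2)
        - (x1 * l1 + e2 * l2) * ((1/2) * e1 * l1 * (l1 + l2)))
        / ((x1 * l1 + x2 * l2) * (e1 * l1 + e2 * l2)) +
        (D.h₂ 0 - D.g 0 * D.p₂ 0) := by ring
    _ = -(l1 * l2 * (e2 * l2 * (e1 - x1) + e1 * l1 * (e2 - x2))
        / (2 * ((x1 * l1 + x2 * l2) * (e1 * l1 + e2 * l2)))) := by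
      rw [bal]; field_simp; ring
    _ < 0 := neg_neg_of_pos (by positivity)

end Swimmer

/-- STLC in the symmetric-magnetization case M1 + M2 = 0. -/
theorem stmt_19 (l1 l2 x1 x2 e1 e2 k M1 M2 : ℝ)
    (hl1 : 0 < l1) (hl2 : 0 < l2) (hx1 : 0 < x1) (hx2 : 0 < x2)
    (he1 : 0 < e1) (he2 : 0 < e2) (hk : 0 < k)
    (hA : AssumptionA l1 l2 x1 x2 e1 e2 M1 M2) (hM : M1 + M2 = 0)
    (xe ye the : ℝ)
    (W : Set (Fin 4 → ℝ)) (hW : W ∈ nhds ![xe, ye, the, 0])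
    (T ε : ℝ) (hT : 0 < T) (hε : 0 < ε) :
    ∃ V ∈ nhds (![xe, ye, the, 0] : Fin 4 → ℝ), V ⊆ W ∧
      ∀ zi ∈ V, ∀ zf ∈ V,
        ∃ Hpar Hperp : ℝ → ℝ, Measurable Hpar ∧ Measurable Hperp ∧
          (∀ t ∈ Icc (0:ℝ) T, |Hpar t| < ε) ∧
          (∀ t ∈ Icc (0:ℝ) T, |Hperp t| < ε) ∧
          ∃ z : ℝ → Fin 4 → ℝ,
            ContinuousOn z (Icc 0 T) ∧ z 0 = zi ∧ z T = zf ∧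
            (∀ t ∈ Icc (0:ℝ) T, z t ∈ W) ∧
            ∀ t ∈ Icc (0:ℝ) T,
              z t = zi + ∫ s in (0:ℝ)..t,
                (F0 l1 l2 x1 x2 e1 e2 k (z s)
                  + Hpar s • F1 l1 l2 x1 x2 e1 e2 M1 (z s)
                  + Hperp s • F2 l1 l2 x1 x2 e1 e2 M1 M2 (z s)) := by
  obtain ⟨hne, h1, h2, hM1, -, -⟩ := hA
  obtain rfl : M2 = -M1 := by linarith
  have hdet : (Emat l1 l2 x1 x2 e1 e2 0).det ≠ 0 := by
    rw [det_Emat_zero]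
    exact neg_ne_zero.2 (by positivity)
  obtain ⟨r, hr, hr1, H⟩ := exists_Emat_radius hl1 hl2 he1 he2 hdet
  obtain ⟨D, hp₁, hp₂, hg, hh₂⟩ := exists_shapeChart hl1 hl2 hx1 hx2 he1 he2 hr H
  obtain ⟨N', hN, hN'⟩ := exists_hasDerivAt_N₁ hl1 hl2 hx1 hx2 he1 he2 hne h1 h2 hdet D hp₁ hp₂
    hg hh₂
  have hbase : D.frame xe ye the 0 = ![xe, ye, the, 0] := by
    simp [ShapeChart.frame, D.G_zero, D.S₁_zero, D.S₂_zero]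
  obtain ⟨V, hV, hsteer⟩ := D.exists_nhds_steers hr hr1 hM1 hk hε hT hN hN' (hbase ▸ hW)
  rw [hbase] at hV
  have hfield : ∀ a b z, F0 l1 l2 x1 x2 e1 e2 k z + a • F1 l1 l2 x1 x2 e1 e2 M1 z
      + b • F2 l1 l2 x1 x2 e1 e2 M1 (-M1) z
      = torqueField k M1 (X3 l1 l2 x1 x2 e1 e2) (X4 l1 l2 x1 x2 e1 e2) a b z := by
    intro a b z
    simp only [F0, F1, F2, torqueField]
    module
  refine ⟨V ∩ W, Filter.inter_mem hV hW, inter_subset_right, fun zi hzi zf hzf => ?_⟩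
  obtain ⟨a, b, ha, hb, haε, hbε, z, hz0, hzT, hzW, hint, hz⟩ := hsteer zi hzi.1 zf hzf.1
  refine ⟨a, b, ha, hb, haε, hbε, z, ?_, hz0, hzT, hzW, ?_⟩
  · have := intervalIntegral.continuousOn_primitive_interval' hint left_mem_uIcc
    rw [uIcc_of_le hT.le] at this
    exact (continuousOn_const.add this).congr hz
  · simpa only [hfield] using hz
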